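/- (Moments of the unitarily invariant norm of a Gaussian matrix) There exists a universal constant C > 0 such that for all integers n, m ≥ 1, each b ∈ {1, 2, 4}, and every unitarily invariant norm ‖·‖ on ℝ^{n×m}: if Z is an n×m random matrix with i.i.d. N(0,1) entries (its law is the product over entries of the standard Gaussian measure), then E[ ‖Z‖^b ] ≤ C · (max(n, m))^{b/2} · ‖I_r‖^b, where r = min(n, m) and I_r ∈ ℝ^{n×m} is the matrix with ones in the entries (i, i) for 1 ≤ i ≤ r and zeros elsewhere. -/

import Mathlib

open MeasureTheory ProbabilityTheory Matrix
open scoped ENNReal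

instance matrixMeasurableSpace {n m : ℕ} : MeasurableSpace (Matrix (Fin n) (Fin m) ℝ) :=
  MeasurableSpace.pi

/-- The law of an `n × m` random matrix with i.i.d. standard Gaussian entries. -/
noncomputable def stdGaussianMatrix (n m : ℕ) : Measure (Matrix (Fin n) (Fin m) ℝ) :=
  Measure.pi fun _ : Fin n => Measure.pi fun _ : Fin m => gaussianReal 0 1

/-- `nrm` is a norm on the space of `n × m` real matrices. -/
def IsMatrixNorm {n m : ℕ} (nrm : Matrix (Fin n) (Fin m) ℝ → ℝ) : Prop :=
  (∀ A B, nrm (A + B) ≤ nrm A + nrm B) ∧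
  (∀ (c : ℝ) A, nrm (c • A) = |c| * nrm A) ∧
  (∀ A, nrm A = 0 → A = 0)

/-- `nrm` is invariant under left and right multiplication by orthogonal matrices. -/
def IsUnitarilyInvariant {n m : ℕ} (nrm : Matrix (Fin n) (Fin m) ℝ → ℝ) : Prop :=
  ∀ (U : Matrix (Fin n) (Fin n) ℝ) (V : Matrix (Fin m) (Fin m) ℝ)
    (A : Matrix (Fin n) (Fin m) ℝ), U * Uᵀ = 1 → V * Vᵀ = 1 → nrm (U * A * V) = nrm A

/-- The `n × m` matrix with ones in the entries `(i, i)` for `i < r` and zeros elsewhere. -/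
def Imat (n m r : ℕ) : Matrix (Fin n) (Fin m) ℝ :=
  Matrix.of fun i j => if (i : ℕ) = (j : ℕ) ∧ (i : ℕ) < r then 1 else 0

section SingularValueDecomposition

variable {E F : Type*} [NormedAddCommGroup E] [InnerProductSpace ℝ E]
  [NormedAddCommGroup F] [InnerProductSpace ℝ F]

/-- Singular value decomposition of a linear map into a space of at least the same dimension. -/
theorem exists_orthonormalBasis_map_eq_smul [FiniteDimensional ℝ E] [FiniteDimensional ℝ F]
    {n m : ℕ} (hE : Module.finrank ℝ E = m) (hF : Module.finrank ℝ F = n) (hmn : m ≤ n)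
    (T : E →ₗ[ℝ] F) :
    ∃ (v : OrthonormalBasis (Fin m) ℝ E) (u : OrthonormalBasis (Fin n) ℝ F),
      ∀ j, T (v j) = ‖T (v j)‖ • u (Fin.castLE hmn j) := by
  have hS : (T.adjoint ∘ₗ T).IsSymmetric := T.isSymmetric_adjoint_comp_self
  let v := hS.eigenvectorBasis hE
  have hv : ∀ i j, i ≠ j → inner ℝ (T (v i)) (T (v j)) = 0 := by
    intro i j hij
    rw [← LinearMap.adjoint_inner_right, ← LinearMap.comp_apply, hS.apply_eigenvectorBasis hE j,
      inner_smul_right, (hS.eigenvectorBasis hE).inner_eq_zero hij, mul_zero]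
  let w : Fin n → F := fun k =>
    if h : (k : ℕ) < m then ‖T (v ⟨k, h⟩)‖⁻¹ • T (v ⟨k, h⟩) else 0
  have hw : ∀ j, w (Fin.castLE hmn j) = ‖T (v j)‖⁻¹ • T (v j) := fun j => by simp [w]
  let s : Set (Fin n) := {k | ∃ j : Fin m, Fin.castLE hmn j = k ∧ T (v j) ≠ 0}
  have horth : Orthonormal ℝ (s.domRestrict w) := by
    constructor
    · rintro ⟨_, j, rfl, hj⟩
      simp only [Set.domRestrict_apply, hw]
      exact norm_smul_inv_norm (𝕜 := ℝ) hj
    · rintro ⟨_, i, rfl, hi⟩ ⟨_, j, rfl, hj⟩ hij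
      have hne : i ≠ j := by
        rintro rfl
        exact hij rfl
      simp only [Set.domRestrict_apply, hw, inner_smul_left, inner_smul_right, hv i j hne, mul_zero]
  obtain ⟨u, hu⟩ := horth.exists_orthonormalBasis_extension_of_card_eq (by simpa using hF)
  refine ⟨v, u, fun j => ?_⟩
  by_cases hj : T (v j) = 0
  · simp [hj]
  · rw [hu _ ⟨j, rfl, hj⟩, hw, smul_inv_smul₀ (norm_ne_zero_iff.2 hj)]

end SingularValueDecomposition

/-- The matrix whose columns are the vectors of an orthonormal basis. -/
noncomputable def orthonormalBasisMatrix {k : ℕ}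
    (b : OrthonormalBasis (Fin k) ℝ (EuclideanSpace ℝ (Fin k))) : Matrix (Fin k) (Fin k) ℝ :=
  Matrix.of fun i j => b j i

theorem orthonormalBasisMatrix_transpose_mul {k : ℕ}
    (b : OrthonormalBasis (Fin k) ℝ (EuclideanSpace ℝ (Fin k))) :
    (orthonormalBasisMatrix b)ᵀ * orthonormalBasisMatrix b = 1 := by
  ext i j
  have h := orthonormal_iff_ite.1 b.orthonormal i j
  simp only [PiLp.inner_apply, RCLike.inner_apply, conj_trivial] at h
  simp only [Matrix.mul_apply, Matrix.transpose_apply, orthonormalBasisMatrix, Matrix.of_apply,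
    Matrix.one_apply]
  rw [← h]
  exact Finset.sum_congr rfl fun _ _ => mul_comm _ _

theorem orthonormalBasisMatrix_mul_transpose {k : ℕ}
    (b : OrthonormalBasis (Fin k) ℝ (EuclideanSpace ℝ (Fin k))) :
    orthonormalBasisMatrix b * (orthonormalBasisMatrix b)ᵀ = 1 :=
  mul_eq_one_comm.1 (orthonormalBasisMatrix_transpose_mul b)

/-- Singular value decomposition of a real matrix with at least as many rows as columns. -/
theorem exists_orthogonal_mul_Imat_mul_diagonal {n m : ℕ} (hmn : m ≤ n)
    (A : Matrix (Fin n) (Fin m) ℝ) {T : ℝ} (hT : ∀ x, ‖A.toEuclideanLin x‖ ≤ T * ‖x‖) :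
    ∃ (U : Matrix (Fin n) (Fin n) ℝ) (V : Matrix (Fin m) (Fin m) ℝ) (σ : Fin m → ℝ),
      U * Uᵀ = 1 ∧ V * Vᵀ = 1 ∧ (∀ j, σ j ∈ Set.Icc (-T) T) ∧
        A = U * (Imat n m m * Matrix.diagonal σ) * V := by
  obtain ⟨v, u, h⟩ := exists_orthonormalBasis_map_eq_smul (n := n) (m := m) (by simp) (by simp)
    hmn A.toEuclideanLin
  have hbound : ∀ j, ‖A.toEuclideanLin (v j)‖ ≤ T := fun j => by simpa using hT (v j)
  refine ⟨orthonormalBasisMatrix u, (orthonormalBasisMatrix v)ᵀ,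
    fun j => ‖A.toEuclideanLin (v j)‖, orthonormalBasisMatrix_mul_transpose u, ?_, ?_, ?_⟩
  · rw [Matrix.transpose_transpose, orthonormalBasisMatrix_transpose_mul]
  · exact fun j => ⟨by linarith [hbound j, norm_nonneg (A.toEuclideanLin (v j))], hbound j⟩
  · have key : A * orthonormalBasisMatrix v = orthonormalBasisMatrix u *
        (Imat n m m * Matrix.diagonal fun j => ‖A.toEuclideanLin (v j)‖) := by
      ext i j
      have hij := congrArg (fun x : EuclideanSpace ℝ (Fin n) => x i) (h j)
      simp only [PiLp.smul_apply, smul_eq_mul, Matrix.ofLp_toLpLin, Matrix.toLin'_apply,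
        Matrix.mulVec, dotProduct] at hij
      have hImat : ∀ k : Fin n, Imat n m m k j = if k = Fin.castLE hmn j then 1 else 0 := by
        intro k
        have : k = Fin.castLE hmn j ↔ (k : ℕ) = j := by simp [Fin.ext_iff]
        simp only [Imat, Matrix.of_apply, this]
        congr 1
        simp only [eq_iff_iff, and_iff_left_iff_imp]
        exact fun hk => hk ▸ j.2
      rw [← Matrix.mul_assoc, Matrix.mul_diagonal]
      simp only [Matrix.mul_apply, orthonormalBasisMatrix, Matrix.of_apply,
        hImat, mul_ite, mul_one, mul_zero, Finset.sum_ite_eq', Finset.mem_univ,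
        if_true]
      rw [hij, mul_comm]
    rw [← key, Matrix.mul_assoc, orthonormalBasisMatrix_mul_transpose, Matrix.mul_one]

theorem IsMatrixNorm.nonneg {n m : ℕ} {nrm : Matrix (Fin n) (Fin m) ℝ → ℝ}
    (h : IsMatrixNorm nrm) (A : Matrix (Fin n) (Fin m) ℝ) : 0 ≤ nrm A := by
  have h0 : nrm 0 = 0 := by simpa using h.2.1 0 0
  have hneg : nrm (-A) = nrm A := by simpa using h.2.1 (-1) A
  have hadd := h.1 A (-A)
  rw [add_neg_cancel, h0, hneg] at hadd
  linarith

/-- For matrices with at least as many rows as columns, a unitarily invariant norm is at most the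
operator norm times its value at the truncated identity. -/
theorem IsMatrixNorm.le_mul_Imat_of_le {n m : ℕ} {nrm : Matrix (Fin n) (Fin m) ℝ → ℝ}
    (h : IsMatrixNorm nrm) (hU : IsUnitarilyInvariant nrm) (hmn : m ≤ n)
    (A : Matrix (Fin n) (Fin m) ℝ) {T : ℝ} (hT0 : 0 ≤ T)
    (hT : ∀ x, ‖A.toEuclideanLin x‖ ≤ T * ‖x‖) :
    nrm A ≤ T * nrm (Imat n m m) := by
  obtain ⟨U, V, σ, hUU, hVV, hσ, rfl⟩ := exists_orthogonal_mul_Imat_mul_diagonal hmn A hT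
  rw [hU U V _ hUU hVV]
  let f : (Fin m → ℝ) → ℝ := fun τ => nrm (Imat n m m * Matrix.diagonal τ)
  have hf : ConvexOn ℝ Set.univ f := by
    refine ⟨convex_univ, fun x _ y _ a b ha hb _ => ?_⟩
    have hxy : Matrix.diagonal (a • x + b • y) = a • Matrix.diagonal x + b • Matrix.diagonal y := by
      rw [← Matrix.diagonal_smul, ← Matrix.diagonal_smul, Matrix.diagonal_add]
      rfl
    simp only [f, hxy, Matrix.mul_add, Matrix.mul_smul, smul_eq_mul]
    refine (h.1 _ _).trans_eq ?_
    rw [h.2.1, h.2.1, abs_of_nonneg ha, abs_of_nonneg hb]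
  have hmem : σ ∈ convexHull ℝ (Set.univ.pi fun _ : Fin m => ({-T, T} : Set ℝ)) := by
    rw [convexHull_pi]
    intro j _
    rw [convexHull_pair, segment_eq_Icc (by linarith)]
    exact hσ j
  obtain ⟨τ, hτ, hle⟩ := hf.exists_ge_of_mem_convexHull (Set.subset_univ _) hmem
  refine hle.trans (le_of_eq ?_)
  have hτ' : ∀ j, ∃ ε : ℝ, ε * ε = 1 ∧ τ j = T * ε := by
    intro j
    rcases hτ j (Set.mem_univ j) with hj | hj
    · exact ⟨-1, by norm_num, by simpa using hj⟩
    · exact ⟨1, by norm_num, by simpa using hj⟩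
  choose ε hε hτε using hτ'
  have hdiag : Matrix.diagonal τ = T • Matrix.diagonal ε := by
    rw [← Matrix.diagonal_smul]
    congr 1
    ext j
    exact hτε j
  have hinv := hU 1 (Matrix.diagonal ε) (Imat n m m) (by simp) (by
    rw [Matrix.diagonal_transpose, Matrix.diagonal_mul_diagonal]
    simp [hε])
  rw [Matrix.one_mul] at hinv
  simp only [f, hdiag, Matrix.mul_smul]
  rw [h.2.1, hinv, abs_of_nonneg hT0]

theorem Imat_transpose (n m r : ℕ) : (Imat n m r)ᵀ = Imat m n r := by
  ext i j
  simp only [Imat, Matrix.transpose_apply, Matrix.of_apply]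
  congr 1
  simp only [eq_iff_iff]
  constructor <;> rintro ⟨h, hr⟩ <;> exact ⟨h.symm, by omega⟩

theorem norm_toEuclideanLin_transpose_le {n m : ℕ} (A : Matrix (Fin n) (Fin m) ℝ) {T : ℝ}
    (hT0 : 0 ≤ T) (hT : ∀ x, ‖A.toEuclideanLin x‖ ≤ T * ‖x‖) (y : EuclideanSpace ℝ (Fin n)) :
    ‖Aᵀ.toEuclideanLin y‖ ≤ T * ‖y‖ := by
  have hadj : Aᵀ.toEuclideanLin = A.toEuclideanLin.adjoint := by
    rw [← Matrix.toEuclideanLin_conjTranspose_eq_adjoint,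
      Matrix.conjTranspose_eq_transpose_of_trivial]
  set z := Aᵀ.toEuclideanLin y with hz
  have h1 : ‖z‖ * ‖z‖ ≤ (T * ‖y‖) * ‖z‖ := by
    calc ‖z‖ * ‖z‖ = inner ℝ (A.toEuclideanLin z) y := by
          rw [← LinearMap.adjoint_inner_right, ← hadj, ← hz, real_inner_self_eq_norm_mul_norm]
      _ ≤ ‖A.toEuclideanLin z‖ * ‖y‖ := real_inner_le_norm _ _
      _ ≤ (T * ‖z‖) * ‖y‖ := by gcongr; exact hT z
      _ = (T * ‖y‖) * ‖z‖ := by ring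
  by_cases h0 : ‖z‖ = 0
  · rw [h0]; positivity
  · exact le_of_mul_le_mul_right h1 (lt_of_le_of_ne (norm_nonneg _) (Ne.symm h0))

/-- A unitarily invariant norm is at most the operator norm times its value at the truncated
identity. -/
theorem IsMatrixNorm.le_mul_Imat_min {n m : ℕ} {nrm : Matrix (Fin n) (Fin m) ℝ → ℝ}
    (h : IsMatrixNorm nrm) (hU : IsUnitarilyInvariant nrm)
    (A : Matrix (Fin n) (Fin m) ℝ) {T : ℝ} (hT0 : 0 ≤ T)
    (hT : ∀ x, ‖A.toEuclideanLin x‖ ≤ T * ‖x‖) :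
    nrm A ≤ T * nrm (Imat n m (min n m)) := by
  rcases le_total m n with hmn | hnm
  · rw [min_eq_right hmn]
    exact h.le_mul_Imat_of_le hU hmn A hT0 hT
  · rw [min_eq_left hnm]
    have h' : IsMatrixNorm fun B : Matrix (Fin m) (Fin n) ℝ => nrm Bᵀ := by
      refine ⟨fun B D => ?_, fun c B => ?_, fun B hB => ?_⟩
      · simpa using h.1 Bᵀ Dᵀ
      · simpa using h.2.1 c Bᵀ
      · simpa using h.2.2 Bᵀ hB
    have hU' : IsUnitarilyInvariant fun B : Matrix (Fin m) (Fin n) ℝ => nrm Bᵀ := by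
      intro U V B hUU hVV
      simp only [Matrix.transpose_mul]
      rw [← Matrix.mul_assoc]
      apply hU
      · rw [Matrix.transpose_transpose]
        exact mul_eq_one_comm.1 hVV
      · rw [Matrix.transpose_transpose]
        exact mul_eq_one_comm.1 hUU
    have := h'.le_mul_Imat_of_le hU' hnm Aᵀ hT0 (norm_toEuclideanLin_transpose_le A hT0 hT)
    simpa [Imat_transpose] using this

/-- The unit ball of a `d`-dimensional real normed space has a `1/2`-net of at most `5 ^ d`
points. -/
theorem exists_half_net_unit_ball (E : Type*) [NormedAddCommGroup E] [NormedSpace ℝ E]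
    [FiniteDimensional ℝ E] :
    ∃ s : Finset E, s.card ≤ 5 ^ Module.finrank ℝ E ∧ (∀ c ∈ s, ‖c‖ ≤ 1) ∧
      ∀ x : E, ‖x‖ ≤ 1 → ∃ c ∈ s, ‖x - c‖ ≤ 1 / 2 := by
  classical
  let P : Finset E → Prop := fun s =>
    (∀ c ∈ s, ‖c‖ ≤ 2) ∧ ∀ c ∈ s, ∀ d ∈ s, c ≠ d → 1 ≤ ‖c - d‖
  have hcard : ∀ s, P s → s.card ≤ 5 ^ Module.finrank ℝ E := fun s hs =>
    Besicovitch.card_le_of_separated s hs.1 hs.2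
  obtain ⟨s, hs, hmax⟩ : ∃ s, P s ∧ ∀ t, P t → t.card ≤ s.card := by
    let Q : ℕ → Prop := fun k => ∃ s, P s ∧ s.card = k
    have hQ0 : Q 0 := ⟨∅, by simp [P], rfl⟩
    obtain ⟨s, hs, hsk⟩ : Q (Nat.findGreatest Q (5 ^ Module.finrank ℝ E)) :=
      Nat.findGreatest_spec (Nat.zero_le _) hQ0
    exact ⟨s, hs, fun t ht => hsk ▸ Nat.le_findGreatest (hcard t ht) ⟨t, ht, rfl⟩⟩
  have hcover : ∀ x : E, ‖x‖ ≤ 2 → ∃ c ∈ s, ‖x - c‖ ≤ 1 := by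
    intro x hx
    by_contra! hfar
    have hxs : x ∉ s := fun hxs => by simpa using (hfar x hxs).trans_le' zero_le_one
    have hins : P (insert x s) := by
      refine ⟨fun c hc => ?_, fun c hc d hd hcd => ?_⟩
      · rcases Finset.mem_insert.1 hc with rfl | hcs
        exacts [hx, hs.1 c hcs]
      · rcases Finset.mem_insert.1 hc with rfl | hcs <;>
          rcases Finset.mem_insert.1 hd with rfl | hds
        · exact absurd rfl hcd
        · exact (hfar d hds).le
        · rw [norm_sub_rev]
          exact (hfar c hcs).le
        · exact hs.2 c hcs d hds hcd
    have := hmax _ hins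
    rw [Finset.card_insert_of_notMem hxs] at this
    omega
  refine ⟨s.image fun c => (1 / 2 : ℝ) • c, Finset.card_image_le.trans (hcard s hs), ?_, ?_⟩
  · intro c hc
    obtain ⟨d, hd, rfl⟩ := Finset.mem_image.1 hc
    rw [norm_smul, Real.norm_of_nonneg (by norm_num)]
    linarith [hs.1 d hd]
  · intro x hx
    obtain ⟨c, hc, hxc⟩ := hcover ((2 : ℝ) • x) (by
      rw [norm_smul, Real.norm_of_nonneg (by norm_num)]
      linarith)
    refine ⟨_, Finset.mem_image_of_mem _ hc, ?_⟩
    have : x - (1 / 2 : ℝ) • c = (1 / 2 : ℝ) • ((2 : ℝ) • x - c) := by module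
    rw [this, norm_smul, Real.norm_of_nonneg (by norm_num)]
    linarith

/-- Half-nets of the unit balls compute the operator norm up to a factor `4`. -/
theorem exists_norm_map_le_four_mul_inner {E F : Type*} [NormedAddCommGroup E]
    [InnerProductSpace ℝ E] [FiniteDimensional ℝ E] [NormedAddCommGroup F] [InnerProductSpace ℝ F]
    {s : Finset E} {t : Finset F} (hs : ∀ x : E, ‖x‖ ≤ 1 → ∃ c ∈ s, ‖x - c‖ ≤ 1 / 2)
    (ht : ∀ x : F, ‖x‖ ≤ 1 → ∃ c ∈ t, ‖x - c‖ ≤ 1 / 2) (A : E →ₗ[ℝ] F) :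
    ∃ x ∈ s, ∃ y ∈ t, 0 ≤ inner ℝ (A x) y ∧ ∀ v, ‖A v‖ ≤ 4 * inner ℝ (A x) y * ‖v‖ := by
  let L : E →L[ℝ] F := LinearMap.toContinuousLinearMap A
  have hne : s.Nonempty := by
    obtain ⟨c, hc, _⟩ := hs 0 (by simp)
    exact ⟨c, hc⟩
  obtain ⟨x, hx, hxmax⟩ := s.exists_max_image (fun c => ‖A c‖) hne
  have hL : ‖L‖ ≤ 2 * ‖A x‖ := by
    have hle : ‖L‖ ≤ ‖A x‖ + ‖L‖ / 2 := by
      refine L.opNorm_le_of_unit_norm (by positivity) fun v hv => ?_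
      obtain ⟨c, hc, hvc⟩ := hs v hv.le
      calc ‖L v‖ = ‖A c + L (v - c)‖ := by
            rw [map_sub]
            congr 1
            simp [L]
        _ ≤ ‖A c‖ + ‖L (v - c)‖ := norm_add_le _ _
        _ ≤ ‖A x‖ + ‖L‖ * ‖v - c‖ := add_le_add (hxmax c hc) (L.le_opNorm _)
        _ ≤ ‖A x‖ + ‖L‖ * (1 / 2) := by gcongr
        _ = ‖A x‖ + ‖L‖ / 2 := by ring
    linarith
  obtain ⟨y, hy, hxy⟩ : ∃ y ∈ t, ‖A x‖ ≤ 2 * inner ℝ (A x) y := by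
    obtain ⟨y, hy, hyw⟩ := ht (‖A x‖⁻¹ • A x) (by
      rw [norm_smul, norm_inv, norm_norm]
      exact inv_mul_le_one)
    refine ⟨y, hy, ?_⟩
    have h1 := (real_inner_le_norm (A x) (‖A x‖⁻¹ • A x - y)).trans
      (mul_le_mul_of_nonneg_left hyw (norm_nonneg _))
    rw [inner_sub_right, inner_smul_right, real_inner_self_eq_norm_mul_norm,
      ← mul_assoc] at h1
    by_cases h0 : ‖A x‖ = 0
    · rw [norm_eq_zero] at h0
      simp [h0]
    · rw [inv_mul_cancel₀ h0] at h1
      linarith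
  refine ⟨x, hx, y, hy, by linarith [norm_nonneg (A x)], fun v => ?_⟩
  refine (L.le_opNorm v).trans (mul_le_mul_of_nonneg_right ?_ (norm_nonneg v))
  linarith

theorem integrable_exp_gaussian_bilinear_and_integral_eq {n m : ℕ} (a : Fin n → Fin m → ℝ) :
    Integrable (fun z : Fin n → Fin m → ℝ => ∏ i, ∏ j, Real.exp (a i j * z i j))
      (Measure.pi fun _ : Fin n => Measure.pi fun _ : Fin m => gaussianReal 0 1) ∧
    ∫ z : Fin n → Fin m → ℝ, ∏ i, ∏ j, Real.exp (a i j * z i j)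
      ∂(Measure.pi fun _ : Fin n => Measure.pi fun _ : Fin m => gaussianReal 0 1) =
      Real.exp ((∑ i, ∑ j, a i j ^ 2) / 2) := by
  constructor
  · exact Integrable.fintype_prod_dep (f := fun i (w : Fin m → ℝ) => ∏ j, Real.exp (a i j * w j))
      fun i => Integrable.fintype_prod_dep (f := fun j (x : ℝ) => Real.exp (a i j * x))
        fun j => integrable_exp_mul_gaussianReal _
  · rw [integral_fintype_prod_eq_prod fun i (w : Fin m → ℝ) => ∏ j, Real.exp (a i j * w j)]
    have hmgf : ∀ c : ℝ, ∫ x, Real.exp (c * x) ∂(gaussianReal 0 1) = Real.exp (c ^ 2 / 2) := by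
      intro c
      have := congrFun (mgf_id_gaussianReal (μ := 0) (v := 1)) c
      simpa [mgf] using this
    have hrow : ∀ i, ∫ w : Fin m → ℝ, ∏ j, Real.exp (a i j * w j)
        ∂(Measure.pi fun _ : Fin m => gaussianReal 0 1) = ∏ j, Real.exp (a i j ^ 2 / 2) := by
      intro i
      rw [integral_fintype_prod_eq_prod fun j (x : ℝ) => Real.exp (a i j * x)]
      simp only [hmgf]
    rw [Finset.prod_congr rfl fun i _ => hrow i]
    simp only [← Real.exp_sum, Finset.sum_div]

/-- Gaussian matrices have subgaussian bilinear forms. -/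
theorem lintegral_exp_inner_stdGaussianMatrix_le {n m : ℕ} (s : ℝ)
    {x : EuclideanSpace ℝ (Fin m)} {y : EuclideanSpace ℝ (Fin n)} (hx : ‖x‖ ≤ 1) (hy : ‖y‖ ≤ 1) :
    ∫⁻ z, ENNReal.ofReal (Real.exp (s * inner ℝ (z.toEuclideanLin x) y))
      ∂(stdGaussianMatrix n m) ≤ ENNReal.ofReal (Real.exp (s ^ 2 / 2)) := by
  have hexp : ∀ z : Matrix (Fin n) (Fin m) ℝ,
      Real.exp (s * inner ℝ (z.toEuclideanLin x) y) =
        ∏ i, ∏ j, Real.exp (s * (y i * x j) * z i j) := by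
    intro z
    simp only [← Real.exp_sum, PiLp.inner_apply, RCLike.inner_apply, conj_trivial,
      Matrix.ofLp_toLpLin, Matrix.toLin'_apply, Matrix.mulVec, dotProduct, Finset.mul_sum]
    congr 1
    exact Finset.sum_congr rfl fun i _ => Finset.sum_congr rfl fun j _ => by ring
  obtain ⟨hint, hval⟩ :=
    integrable_exp_gaussian_bilinear_and_integral_eq fun (i : Fin n) (j : Fin m) => s * (y i * x j)
  simp only [hexp]
  refine (ofReal_integral_eq_lintegral_ofReal hint
    (Filter.Eventually.of_forall fun z => by positivity)).symm.trans_le ?_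
  refine ENNReal.ofReal_le_ofReal (hval.trans_le (Real.exp_le_exp.2 ?_))
  have hsum : ∑ i, ∑ j, (s * (y i * x j)) ^ 2 = s ^ 2 * (‖y‖ ^ 2 * ‖x‖ ^ 2) := by
    rw [EuclideanSpace.real_norm_sq_eq, EuclideanSpace.real_norm_sq_eq, Finset.sum_mul_sum,
      Finset.mul_sum]
    refine Finset.sum_congr rfl fun i _ => ?_
    rw [Finset.mul_sum]
    exact Finset.sum_congr rfl fun j _ => by ring
  rw [hsum]
  have h1 : ‖y‖ ^ 2 * ‖x‖ ^ 2 ≤ 1 :=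
    mul_le_one₀ (pow_le_one₀ (norm_nonneg _) hy) (by positivity) (pow_le_one₀ (norm_nonneg _) hx)
  nlinarith [sq_nonneg s]

/-- Truncated exponential bound for low powers. -/
theorem pow_le_const_add_exp {b : ℕ} (hb : b ≤ 4) {u : ℝ} (hu : 0 ≤ u) {N : ℝ} (hN : 1 ≤ N) :
    u ^ b ≤ 257 + 24 * Real.exp 4 * Real.exp (N * (u - 4)) := by
  have hexp := mul_pos (Real.exp_pos 4) (Real.exp_pos (N * (u - 4)))
  have hpow : u ^ b ≤ 1 + u ^ 4 := by
    rcases le_total u 1 with h | h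
    · linarith [pow_le_one₀ (n := b) hu h, pow_nonneg hu 4]
    · linarith [pow_le_pow_right₀ h hb]
  have hfour : u ^ 4 ≤ 256 + 24 * Real.exp 4 * Real.exp (N * (u - 4)) := by
    rcases le_total u 4 with h | h
    · have : u ^ 4 ≤ 4 ^ 4 := pow_le_pow_left₀ hu h 4
      linarith
    · have h1 : u ^ 4 / 24 ≤ Real.exp u := by
        simpa [Nat.factorial] using Real.pow_div_factorial_le_exp u hu 4
      have h2 : Real.exp u ≤ Real.exp 4 * Real.exp (N * (u - 4)) := by
        rw [← Real.exp_add, Real.exp_le_exp]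
        nlinarith
      linarith
  linarith

theorem twenty_five_pow_mul_exp_le_one (N : ℕ) :
    (25 : ℝ) ^ N * (Real.exp (-(4 * N)) * Real.exp ((N : ℝ) / 2)) ≤ 1 := by
  have h25 : (25 : ℝ) ≤ Real.exp (7 / 2) := by
    have h := Real.exp_one_gt_d9
    have h7 : Real.exp (7 / 2) ^ 2 = Real.exp 1 ^ 7 := by
      rw [← Real.exp_nat_mul, ← Real.exp_nat_mul]
      norm_num
    have h8 : (2.7 : ℝ) ^ 7 ≤ Real.exp 1 ^ 7 := pow_le_pow_left₀ (by norm_num) (by linarith) 7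
    by_contra! hlt
    have := pow_lt_pow_left₀ hlt (Real.exp_pos _).le two_ne_zero
    norm_num at this h7 h8
    linarith
  calc (25 : ℝ) ^ N * (Real.exp (-(4 * N)) * Real.exp ((N : ℝ) / 2))
      ≤ Real.exp (7 / 2) ^ N * (Real.exp (-(4 * N)) * Real.exp ((N : ℝ) / 2)) := by gcongr
    _ = 1 := by
      rw [← Real.exp_nat_mul, ← Real.exp_add, ← Real.exp_add, Real.exp_eq_one_iff]
      ring

theorem measurable_inner_toEuclideanLin {n m : ℕ} (x : EuclideanSpace ℝ (Fin m))
    (y : EuclideanSpace ℝ (Fin n)) :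
    Measurable fun z : Matrix (Fin n) (Fin m) ℝ => (inner ℝ (z.toEuclideanLin x) y : ℝ) := by
  simp only [PiLp.inner_apply, RCLike.inner_apply, conj_trivial, Matrix.ofLp_toLpLin,
    Matrix.toLin'_apply, Matrix.mulVec, dotProduct]
  refine Finset.measurable_sum _ fun i _ => Measurable.const_mul ?_ _
  refine Finset.measurable_sum _ fun j _ => Measurable.mul_const ?_ _
  exact (measurable_pi_apply j).comp (measurable_pi_apply i)

instance isProbabilityMeasure_stdGaussianMatrix (n m : ℕ) :
    IsProbabilityMeasure (stdGaussianMatrix n m) :=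
  inferInstanceAs (IsProbabilityMeasure
    (Measure.pi fun _ : Fin n => Measure.pi fun _ : Fin m => gaussianReal 0 1))

theorem lintegral_sum_exp_inner_stdGaussianMatrix_le_one {n m : ℕ}
    {S : Finset (EuclideanSpace ℝ (Fin m))} {T : Finset (EuclideanSpace ℝ (Fin n))}
    (hSc : S.card ≤ 5 ^ m) (hTc : T.card ≤ 5 ^ n) (hS : ∀ x ∈ S, ‖x‖ ≤ 1) (hT : ∀ y ∈ T, ‖y‖ ≤ 1) :
    ∫⁻ z, ∑ p ∈ S ×ˢ T, ENNReal.ofReal (Real.exp (-(4 * ((max n m : ℕ) : ℝ)))) *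
      ENNReal.ofReal (Real.exp (√((max n m : ℕ) : ℝ) * inner ℝ (z.toEuclideanLin p.1) p.2))
      ∂(stdGaussianMatrix n m) ≤ 1 := by
  set N := max n m with hN
  have hcard : (S ×ˢ T).card ≤ 25 ^ N := by
    rw [Finset.card_product, show 25 = 5 * 5 from rfl, mul_pow]
    exact Nat.mul_le_mul (hSc.trans (Nat.pow_le_pow_right (by norm_num) (le_max_right n m)))
      (hTc.trans (Nat.pow_le_pow_right (by norm_num) (le_max_left n m)))
  rw [lintegral_finsetSum _ fun p _ => ((((measurable_inner_toEuclideanLin p.1 p.2).const_mul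
    _).exp).ennreal_ofReal).const_mul _]
  have hterm : ∀ p ∈ S ×ˢ T, ∫⁻ z, ENNReal.ofReal (Real.exp (-(4 * (N : ℝ)))) *
      ENNReal.ofReal (Real.exp (√(N : ℝ) * inner ℝ (z.toEuclideanLin p.1) p.2))
      ∂(stdGaussianMatrix n m) ≤
      ENNReal.ofReal (Real.exp (-(4 * (N : ℝ))) * Real.exp ((N : ℝ) / 2)) := by
    intro p hp
    rw [Finset.mem_product] at hp
    rw [lintegral_const_mul' _ _ ENNReal.ofReal_ne_top, ENNReal.ofReal_mul (Real.exp_pos _).le]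
    gcongr
    refine (lintegral_exp_inner_stdGaussianMatrix_le _ (hS _ hp.1) (hT _ hp.2)).trans_eq ?_
    rw [Real.sq_sqrt (Nat.cast_nonneg N)]
  refine (Finset.sum_le_card_nsmul _ _ _ hterm).trans ?_
  rw [nsmul_eq_mul, ← ENNReal.ofReal_natCast, ← ENNReal.ofReal_mul (Nat.cast_nonneg _),
    ← ENNReal.ofReal_one]
  refine ENNReal.ofReal_le_ofReal ((mul_le_mul_of_nonneg_right ?_ (by positivity)).trans
    (twenty_five_pow_mul_exp_le_one N))
  exact_mod_cast hcard

theorem IsMatrixNorm.pow_le_of_map_le {n m : ℕ} {nrm : Matrix (Fin n) (Fin m) ℝ → ℝ}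
    (h : IsMatrixNorm nrm) (hU : IsUnitarilyInvariant nrm) {z : Matrix (Fin n) (Fin m) ℝ}
    {q : ℝ} (hq0 : 0 ≤ q) (hq : ∀ v, ‖z.toEuclideanLin v‖ ≤ 4 * q * ‖v‖) {b : ℕ} (hb : b ≤ 4)
    {N : ℝ} (hN : 1 ≤ N) :
    nrm z ^ b ≤ 256 * (√N ^ b * nrm (Imat n m (min n m)) ^ b) *
      (257 + 24 * Real.exp 4 * (Real.exp (-(4 * N)) * Real.exp (√N * q))) := by
  have hs : 0 < √N := Real.sqrt_pos.2 (by linarith)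
  obtain ⟨u, hu, rfl⟩ : ∃ u, 0 ≤ u ∧ q = √N * u :=
    ⟨q / √N, div_nonneg hq0 hs.le, (mul_div_cancel₀ q hs.ne').symm⟩
  have h1 := h.le_mul_Imat_min hU z (by positivity) hq
  have h2 : Real.exp (-(4 * N)) * Real.exp (√N * (√N * u)) = Real.exp (N * (u - 4)) := by
    rw [← Real.exp_add, ← mul_assoc, Real.mul_self_sqrt (by linarith)]
    congr 1
    ring
  have h4 : (4 : ℝ) ^ b ≤ 256 := by
    calc (4 : ℝ) ^ b ≤ 4 ^ 4 := pow_le_pow_right₀ (by norm_num) hb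
      _ = 256 := by norm_num
  have hI := h.nonneg (Imat n m (min n m))
  rw [h2]
  calc nrm z ^ b ≤ (4 * (√N * u) * nrm (Imat n m (min n m))) ^ b :=
        pow_le_pow_left₀ (h.nonneg z) h1 b
    _ = 4 ^ b * (√N ^ b * nrm (Imat n m (min n m)) ^ b) * u ^ b := by ring
    _ ≤ 256 * (√N ^ b * nrm (Imat n m (min n m)) ^ b) * u ^ b := by gcongr
    _ ≤ _ := mul_le_mul_of_nonneg_left (pow_le_const_add_exp hb hu hN) (by positivity)

theorem lintegral_ofReal_norm_pow_le {n m : ℕ} (hn : 1 ≤ n) {b : ℕ} (hb : b ≤ 4)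
    {nrm : Matrix (Fin n) (Fin m) ℝ → ℝ} (h : IsMatrixNorm nrm) (hU : IsUnitarilyInvariant nrm) :
    ∫⁻ z, ENNReal.ofReal (nrm z ^ b) ∂(stdGaussianMatrix n m) ≤
      ENNReal.ofReal (256 * (257 + 24 * Real.exp 4) *
        √((max n m : ℕ) : ℝ) ^ b * nrm (Imat n m (min n m)) ^ b) := by
  obtain ⟨S, hSc, hS1, hS⟩ := exists_half_net_unit_ball (EuclideanSpace ℝ (Fin m))
  obtain ⟨T, hTc, hT1, hT⟩ := exists_half_net_unit_ball (EuclideanSpace ℝ (Fin n))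
  rw [finrank_euclideanSpace_fin] at hSc hTc
  have hsum := lintegral_sum_exp_inner_stdGaussianMatrix_le_one hSc hTc hS1 hT1
  set N := max n m with hN
  have hN1 : (1 : ℝ) ≤ N := by exact_mod_cast hn.trans (le_max_left n m)
  set I := nrm (Imat n m (min n m)) with hI
  have hI0 : 0 ≤ I := h.nonneg _
  set K := 256 * (√(N : ℝ) ^ b * I ^ b) with hK
  have hK0 : 0 ≤ K := by positivity
  have hpt : ∀ z : Matrix (Fin n) (Fin m) ℝ, ENNReal.ofReal (nrm z ^ b) ≤ ENNReal.ofReal K *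
      (ENNReal.ofReal 257 + ENNReal.ofReal (24 * Real.exp 4) *
        ∑ p ∈ S ×ˢ T, ENNReal.ofReal (Real.exp (-(4 * (N : ℝ)))) *
          ENNReal.ofReal (Real.exp (√(N : ℝ) * inner ℝ (z.toEuclideanLin p.1) p.2))) := by
    intro z
    obtain ⟨x, hx, y, hy, hq0, hq⟩ := exists_norm_map_le_four_mul_inner hS hT z.toEuclideanLin
    have hnz := h.pow_le_of_map_le hU hq0 hq hb hN1
    let f : EuclideanSpace ℝ (Fin m) × EuclideanSpace ℝ (Fin n) → ℝ≥0∞ := fun p =>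
      ENNReal.ofReal (Real.exp (-(4 * (N : ℝ)))) *
        ENNReal.ofReal (Real.exp (√(N : ℝ) * inner ℝ (z.toEuclideanLin p.1) p.2))
    have hsingle : f (x, y) ≤ ∑ p ∈ S ×ˢ T, f p :=
      Finset.single_le_sum_of_canonicallyOrdered (Finset.mk_mem_product hx hy)
    refine (ENNReal.ofReal_le_ofReal hnz).trans ?_
    rw [ENNReal.ofReal_mul hK0, ENNReal.ofReal_add (by norm_num) (by positivity),
      ENNReal.ofReal_mul (p := 24 * Real.exp 4) (by positivity),
      ENNReal.ofReal_mul (Real.exp_pos _).le]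
    gcongr
  refine (lintegral_mono hpt).trans ?_
  rw [lintegral_const_mul' _ _ ENNReal.ofReal_ne_top, lintegral_add_left measurable_const,
    lintegral_const_mul' _ _ ENNReal.ofReal_ne_top, lintegral_const, measure_univ, mul_one]
  calc _ ≤ ENNReal.ofReal K * (ENNReal.ofReal 257 + ENNReal.ofReal (24 * Real.exp 4) * 1) := by
        gcongr
    _ = _ := by
      rw [mul_one, ← ENNReal.ofReal_add (by norm_num) (by positivity), ← ENNReal.ofReal_mul hK0]
      congr 1
      ring

/-- Moments of the unitarily invariant norm of a Gaussian matrix: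
there is a universal constant `C > 0` such that for all `n, m ≥ 1`, each
`b ∈ {1, 2, 4}`, and every unitarily invariant norm `‖·‖` on `ℝ^{n×m}`, an `n × m`
matrix `Z` of i.i.d. `N(0,1)` entries satisfies
`E[‖Z‖^b] ≤ C · (max(n,m))^{b/2} · ‖I_r‖^b` with `r = min(n,m)`. -/
theorem gaussian_matrix_unitarily_invariant_norm_moments :
    ∃ C : ℝ, 0 < C ∧
      ∀ (n m : ℕ), 1 ≤ n → 1 ≤ m → ∀ b : ℕ, (b = 1 ∨ b = 2 ∨ b = 4) →
        ∀ nrm : Matrix (Fin n) (Fin m) ℝ → ℝ,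
          IsMatrixNorm nrm → IsUnitarilyInvariant nrm →
          (∫⁻ z, ENNReal.ofReal (nrm z ^ b) ∂(stdGaussianMatrix n m))
            ≤ ENNReal.ofReal
                (C * (max n m : ℝ) ^ ((b : ℝ) / 2) * nrm (Imat n m (min n m)) ^ b) := by
  refine ⟨256 * (257 + 24 * Real.exp 4), by positivity, ?_⟩
  intro n m hn _ b hb nrm h hU
  refine (lintegral_ofReal_norm_pow_le hn (by omega) h hU).trans_eq ?_
  rw [Real.rpow_div_two_eq_sqrt _ (by positivity), Real.rpow_natCast, Nat.cast_max]
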